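/- Let G be a connected rayless graph. Then either G has no connected strong twin, or there exist infinitely many pairwise non-isomorphic connected graphs each of which is a strong twin of G. -/

import Mathlib

/-- A graph is rayless if it contains no ray, i.e. no infinite sequence of distinct
vertices `v₀, v₁, v₂, …` with `vᵢ` adjacent to `vᵢ₊₁` for all `i`. -/
def SimpleGraph.IsRayless {V : Type*} (G : SimpleGraph V) : Prop :=
  ¬ ∃ f : ℕ → V, Function.Injective f ∧ ∀ n, G.Adj (f n) (f (n + 1))

/-- Two graphs are strong twins if they are non-isomorphic and each embeds into the
other (as an induced subgraph). -/
def SimpleGraph.StrongTwins {V W : Type*} (G : SimpleGraph V) (H : SimpleGraph W) : Prop :=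
  ¬ Nonempty (G ≃g H) ∧ Nonempty (G ↪g H) ∧ Nonempty (H ↪g G)

universe u

namespace RT

/-! ### Connected vertex sets and Schmidt rank -/

/-- `A` is a connected (nonempty) vertex set of `G`. -/
def Conn {V : Type u} (G : SimpleGraph V) (A : Set V) : Prop :=
  A.Nonempty ∧ ∀ P : Set V, (∃ x ∈ A, x ∈ P) →
    (∀ a ∈ A, ∀ b ∈ A, a ∈ P → G.Adj a b → b ∈ P) → A ⊆ P

def Comp {V : Type u} (G : SimpleGraph V) (A : Set V) (c : V) : Set V :=
  {x | Relation.ReflTransGen (fun a b => G.Adj a b ∧ b ∈ A) c x}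

theorem mem_comp {V : Type u} (G : SimpleGraph V) (A : Set V) (c : V) : c ∈ Comp G A c :=
  Relation.ReflTransGen.refl

theorem comp_step {V : Type u} {G : SimpleGraph V} {A : Set V} {c a b : V}
    (ha : a ∈ Comp G A c) (h : G.Adj a b) (hb : b ∈ A) : b ∈ Comp G A c :=
  Relation.ReflTransGen.tail ha ⟨h, hb⟩

theorem comp_sub {V : Type u} {G : SimpleGraph V} {A : Set V} {c : V} (hc : c ∈ A) :
    Comp G A c ⊆ A := by
  intro x hx
  induction hx with
  | refl => exact hc
  | tail _ h _ => exact h.2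

theorem comp_conn {V : Type u} (G : SimpleGraph V) (A : Set V) (c : V) :
    Conn G (Comp G A c) := by
  refine ⟨⟨c, mem_comp G A c⟩, ?_⟩
  rintro P ⟨x, hx, hxP⟩ hP
  have hcP : c ∈ P := by
    have : ∀ y, Relation.ReflTransGen (fun a b => G.Adj a b ∧ b ∈ A) c y → y ∈ P → c ∈ P := by
      intro y hy
      induction hy with
      | refl => exact id
      | tail h1 h2 ih =>
        intro hb
        exact ih (hP _ (Relation.ReflTransGen.tail h1 h2) _ h1 hb h2.1.symm)
    exact this x hx hxP
  intro y hy
  have hy' : Relation.ReflTransGen (fun a b => G.Adj a b ∧ b ∈ A) c y := hy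
  clear hy
  induction hy' with
  | refl => exact hcP
  | tail h1 h2 ih => exact hP _ h1 _ (Relation.ReflTransGen.tail h1 h2) ih h2.1

theorem comp_max {V : Type u} {G : SimpleGraph V} {A B : Set V} {c : V} (hB : Conn G B)
    (hBA : B ⊆ A) (h : ∃ x ∈ B, x ∈ Comp G A c) : B ⊆ Comp G A c :=
  hB.2 _ h fun _ _ _ hb hac hadj => comp_step hac hadj (hBA hb)

theorem comp_adj {V : Type u} {G : SimpleGraph V} {A : Set V} (hA : Conn G A) {v c : V}
    (hv : v ∈ A) (hc : c ∈ A \ {v}) : ∃ w ∈ Comp G (A \ {v}) c, G.Adj v w := by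
  by_contra hcon
  push Not at hcon
  have := hA.2 (Comp G (A \ {v}) c) ⟨c, hc.1, mem_comp _ _ _⟩ (by
    intro a _ b hb hac hadj
    by_cases hbv : b = v
    · subst hbv
      exact absurd hadj.symm (hcon a hac)
    · exact comp_step hac hadj ⟨hb, hbv⟩)
  exact (comp_sub hc (this hv)).2 rfl

theorem conn_image {V W : Type u} {G : SimpleGraph V} {H : SimpleGraph W} {f : V → W}
    (hf : ∀ x y, G.Adj x y → H.Adj (f x) (f y)) {A : Set V} (hA : Conn G A) :
    Conn H (f '' A) := by
  refine ⟨hA.1.image f, ?_⟩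
  rintro P ⟨_, ⟨x, hx, rfl⟩, hxP⟩ hP
  have := hA.2 (f ⁻¹' P) ⟨x, hx, hxP⟩ (fun a ha b hb hap hab =>
    hP _ ⟨a, ha, rfl⟩ _ ⟨b, hb, rfl⟩ hap (hf _ _ hab))
  rintro _ ⟨y, hy, rfl⟩
  exact this hy

def HasRk {V : Type u} (G : SimpleGraph V) (α : Ordinal.{u}) (A : Set V) : Prop :=
  ∃ S : Set V, S.Finite ∧ ∀ C : Set V, C ⊆ A \ S → Conn G C →
    ∃ β : Ordinal.{u}, ∃ _ : β < α, HasRk G β C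
termination_by α

theorem hasRk_iff {V : Type u} {G : SimpleGraph V} {α : Ordinal.{u}} {A : Set V} :
    HasRk G α A ↔ ∃ S : Set V, S.Finite ∧ ∀ C : Set V, C ⊆ A \ S → Conn G C →
      ∃ β < α, HasRk G β C := by
  rw [HasRk]; simp only [exists_prop]

theorem HasRk.mono {V : Type u} {G : SimpleGraph V} {α α' : Ordinal.{u}} {A A' : Set V}
    (h : HasRk G α A) (hα : α ≤ α') (hA : A' ⊆ A) : HasRk G α' A' := by
  rw [hasRk_iff] at h ⊢
  obtain ⟨S, hS, h⟩ := h
  refine ⟨S, hS, fun C hC hc => ?_⟩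
  obtain ⟨β, hβ, hb⟩ := h C (fun x hx => ⟨hA (hC hx).1, (hC hx).2⟩) hc
  exact ⟨β, hβ.trans_le hα, hb⟩

theorem HasRk.preimage {V W : Type u} {G : SimpleGraph V} {H : SimpleGraph W} {f : V → W}
    (hf : ∀ x y, G.Adj x y → H.Adj (f x) (f y)) (hinj : Function.Injective f)
    {α : Ordinal.{u}} : ∀ {B : Set W}, HasRk H α B → HasRk G α (f ⁻¹' B) := by
  induction α using WellFoundedLT.induction with
  | ind α ih =>
    intro B h
    rw [hasRk_iff] at h ⊢
    obtain ⟨S, hS, h⟩ := h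
    refine ⟨f ⁻¹' S, hS.preimage hinj.injOn, fun C hC hc => ?_⟩
    obtain ⟨β, hβ, hb⟩ := h (f '' C) (by
      rintro _ ⟨x, hx, rfl⟩; exact hC hx) (conn_image hf hc)
    refine ⟨β, hβ, ?_⟩
    have := ih β hβ hb
    rwa [Set.preimage_image_eq _ hinj] at this

/-- every connected set in `A` has a rank implies `A` has one -/
theorem exists_rank {V : Type u} {G : SimpleGraph V} (A S : Set V) (hS : S.Finite)
    (h : ∀ C : Set V, C ⊆ A \ S → Conn G C → ∃ β, HasRk G β C) : ∃ α, HasRk G α A := by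
  classical
  let r : Set V → Ordinal.{u} := fun C =>
    if hC : ∃ β, HasRk G β C then Order.succ hC.choose else 0
  refine ⟨⨆ C, r C, ?_⟩
  rw [hasRk_iff]
  refine ⟨S, hS, fun C hC hc => ?_⟩
  have hr := h C hC hc
  refine ⟨hr.choose, ?_, hr.choose_spec⟩
  have h1 : r C = Order.succ hr.choose := by simp only [r]; rw [dif_pos hr]
  have h2 : r C ≤ ⨆ C, r C := Ordinal.le_iSup r C
  rw [h1] at h2
  exact Order.succ_le_iff.mp h2

theorem rayless_rank {V : Type u} {G : SimpleGraph V}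
    (hG : ¬ ∃ f : ℕ → V, Function.Injective f ∧ ∀ n, G.Adj (f n) (f (n + 1)))
    (hc : Conn G Set.univ) : ∃ α, HasRk G α Set.univ := by
  by_contra hno
  apply hG
  let St := {p : Set V × V // Conn G p.1 ∧ p.2 ∈ p.1 ∧ ¬ ∃ α, HasRk G α p.1}
  have step : ∀ p : St, ∃ q : St, q.1.1 ⊆ p.1.1 \ {p.1.2} ∧ G.Adj p.1.2 q.1.2 := by
    rintro ⟨⟨A, v⟩, hA, hv, hr⟩
    have : ∃ C : Set V, C ⊆ A \ {v} ∧ Conn G C ∧ ¬ ∃ β, HasRk G β C := by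
      by_contra hcon
      push Not at hcon
      exact hr (exists_rank A {v} (Set.finite_singleton v) hcon)
    obtain ⟨C, hCA, hC, hCr⟩ := this
    obtain ⟨c, hcC⟩ := hC.1
    obtain ⟨w, hw, hvw⟩ := comp_adj hA hv (hCA hcC)
    refine ⟨⟨⟨Comp G (A \ {v}) c, w⟩, comp_conn _ _ _, hw, ?_⟩, comp_sub (hCA hcC), hvw⟩
    rintro ⟨α, hα⟩
    exact hCr ⟨α, hα.mono le_rfl (comp_max hC hCA ⟨c, hcC, mem_comp _ _ _⟩)⟩
  choose nx h1 h2 using step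
  obtain ⟨v0, _⟩ := hc.1
  let s : ℕ → St := fun n => nx^[n] ⟨⟨Set.univ, v0⟩, hc, Set.mem_univ _, hno⟩
  have hs : ∀ n, s (n + 1) = nx (s n) := fun n => Function.iterate_succ_apply' _ _ _
  have hmono : ∀ n m, (s (n + m)).1.1 ⊆ (s n).1.1 := by
    intro n m
    induction m with
    | zero => exact subset_rfl
    | succ m ih =>
      intro x hx
      rw [← add_assoc, hs] at hx
      exact ih (h1 _ hx).1
  have hne : ∀ n m, n < m → (s n).1.2 ≠ (s m).1.2 := by
    intro n m hnm heq
    obtain ⟨k, rfl⟩ := Nat.exists_eq_add_of_lt hnm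
    have hm := (s (n + k + 1)).2.2.1
    have e : n + k + 1 = (n + 1) + k := by ring
    rw [← heq, e] at hm
    have := hmono (n + 1) k hm
    rw [hs] at this
    exact (h1 _ this).2 rfl
  refine ⟨fun n => (s n).1.2, ?_, ?_⟩
  · intro n m h
    rcases lt_trichotomy n m with hlt | heq | hlt
    · exact absurd h (hne _ _ hlt)
    · exact heq
    · exact absurd h.symm (hne _ _ hlt)
  · intro n
    show G.Adj (s n).1.2 (s (n + 1)).1.2
    rw [hs]; exact h2 _

/-- gluing: finitely many pieces of rank `< α` -/
theorem glue {V : Type u} {G : SimpleGraph V} {α : Ordinal.{u}} (C T : Set V) (hT : T.Finite)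
    {ι : Type u} (F : ι → Set V) (fin : Finite ι) (ne : Nonempty ι)
    (hF : ∀ i, ∃ β < α, HasRk G β (F i))
    (hB : ∀ B, B ⊆ C \ T → Conn G B → ∃ i, B ⊆ F i) : ∃ β < α, HasRk G β C := by
  choose r hr hrF using hF
  obtain ⟨i0, hi0⟩ := Finite.exists_max r
  refine ⟨r i0, hr i0, ?_⟩
  have hF' := fun i => hasRk_iff.1 ((hrF i).mono (hi0 i) subset_rfl)
  choose S hS hSF using hF'
  rw [hasRk_iff]
  refine ⟨T ∪ ⋃ i, S i, hT.union (Set.finite_iUnion hS), fun B hBC hBc => ?_⟩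
  obtain ⟨i, hi⟩ := hB B (fun x hx => ⟨(hBC hx).1, fun h => (hBC hx).2 (Or.inl h)⟩) hBc
  exact hSF i B (fun x hx => ⟨hi hx, fun h =>
    (hBC hx).2 (Or.inr (Set.mem_iUnion.2 ⟨i, h⟩))⟩) hBc

/-- the kernel -/
def Ker {V : Type u} (G : SimpleGraph V) (α : Ordinal.{u}) : Set V :=
  {v | ∀ T : Set V, T.Finite → v ∉ T → ∃ D, Conn G D ∧ v ∈ D ∧ D ⊆ Tᶜ ∧
    ¬ ∃ β < α, HasRk G β D}

def Wit {V : Type u} (G : SimpleGraph V) (α : Ordinal.{u}) (S : Set V) : Prop :=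
  ∀ C : Set V, C ⊆ Sᶜ → Conn G C → ∃ β < α, HasRk G β C

theorem ker_emb {V : Type u} {G : SimpleGraph V} {f : V → V}
    (hf : ∀ x y, G.Adj x y → G.Adj (f x) (f y)) (hinj : Function.Injective f)
    {α : Ordinal.{u}} {v : V} (hv : v ∈ Ker G α) : f v ∈ Ker G α := by
  intro T hT hvT
  obtain ⟨D, hD, hvD, hDT, hr⟩ := hv (f ⁻¹' T) (hT.preimage hinj.injOn) hvT
  refine ⟨f '' D, conn_image hf hD, ⟨v, hvD, rfl⟩, ?_, ?_⟩
  · rintro _ ⟨x, hx, rfl⟩; exact hDT hx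
  · rintro ⟨β, hβ, hb⟩
    have := HasRk.preimage hf hinj hb
    rw [Set.preimage_image_eq _ hinj] at this
    exact hr ⟨β, hβ, this⟩

theorem wit_remove {V : Type u} {G : SimpleGraph V} {α : Ordinal.{u}} {S : Set V}
    (hw : Wit G α S) {v : V} (hv : v ∉ Ker G α) : Wit G α (S \ {v}) := by
  intro C hCS hC
  by_cases hvC : v ∈ C
  swap
  · refine hw C (fun x hx hxS => hCS hx ⟨hxS, ?_⟩) hC
    rintro rfl; exact hvC hx
  simp only [Ker, Set.mem_ofPred_eq, not_forall] at hv
  obtain ⟨T, hT, hvT, hD⟩ := hv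
  push Not at hD
  let F : Option {t // t ∈ T ∧ t ∈ C \ {v}} → Set V := fun o =>
    match o with
    | none => Comp G (C \ T) v
    | some t => Comp G (C \ {v}) t.1
  have : Finite {t // t ∈ T ∧ t ∈ C \ {v}} := (hT.subset (fun x hx => hx.1) : {t | t ∈ T ∧ t ∈ C \ {v}}.Finite)
  refine glue C T hT F inferInstance ⟨none⟩ ?_ ?_
  · rintro (_ | t)
    · exact hD _ (comp_conn _ _ _) (mem_comp _ _ _) (fun x hx =>
        (comp_sub (show v ∈ C \ T from ⟨hvC, hvT⟩) hx).2)
    · refine hw _ (fun x hx hxS => ?_) (comp_conn _ _ _)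
      have := comp_sub t.2.2 hx
      exact hCS this.1 ⟨hxS, this.2⟩
  · intro B hB hBc
    by_cases hvB : v ∈ B
    · exact ⟨none, comp_max hBc hB ⟨v, hvB, mem_comp _ _ _⟩⟩
    have hBv : B ⊆ C \ {v} := fun x hx => ⟨(hB hx).1, by rintro rfl; exact hvB hx⟩
    obtain ⟨b, hb⟩ := hBc.1
    have hBE : B ⊆ Comp G (C \ {v}) b := comp_max hBc hBv ⟨b, hb, mem_comp _ _ _⟩
    have hEc := comp_conn G (C \ {v}) b
    have hEs : Comp G (C \ {v}) b ⊆ C \ {v} := comp_sub (hBv hb)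
    by_cases hE : ∃ t ∈ T, t ∈ Comp G (C \ {v}) b
    · obtain ⟨t, htT, htE⟩ := hE
      refine ⟨some ⟨t, htT, hEs htE⟩, hBE.trans ?_⟩
      exact comp_max hEc hEs ⟨t, htE, mem_comp _ _ _⟩
    · push Not at hE
      obtain ⟨w, hwE, hvw⟩ := comp_adj hC hvC (hBv hb)
      refine ⟨none, hBE.trans ?_⟩
      have hs : Comp G (C \ {v}) b ⊆ C \ T := fun x hx => ⟨(hEs hx).1, fun h => hE x h hx⟩
      exact comp_max hEc hs ⟨w, hwE, comp_step (mem_comp _ _ _) hvw (hs hwE)⟩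

/-- The kernel of a connected graph of rank exactly `α`. -/
theorem exists_kernel {V : Type u} {G : SimpleGraph V} {α : Ordinal.{u}}
    (hc : Conn G Set.univ) (hr : HasRk G α Set.univ)
    (hmin : ∀ β < α, ¬ HasRk G β Set.univ) :
    ∃ K : Set V, K.Finite ∧ K.Nonempty ∧ Wit G α K ∧
      ∀ f : V → V, Function.Injective f → (∀ x y, G.Adj x y → G.Adj (f x) (f y)) →
        ∀ v ∈ K, f v ∈ K := by
  rw [hasRk_iff] at hr
  obtain ⟨S, hS, hw⟩ := hr
  have hw : Wit G α S := fun C hC => hw C (fun x hx => ⟨trivial, hC hx⟩)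
  have key : ∀ A : Set V, A.Finite → Wit G α (S \ (A \ Ker G α)) := by
    intro A hA
    induction A, hA using Set.Finite.induction_on with
    | empty => simpa using hw
    | @insert a A _ _ ih =>
      by_cases ha : a ∈ Ker G α
      · rwa [Set.insert_sdiff_of_mem _ ha]
      · have := wit_remove ih ha
        rwa [Set.sdiff_sdiff, Set.union_singleton, ← Set.insert_sdiff_of_notMem _ ha] at this
  have hK : Ker G α ⊆ S := by
    intro v hv
    by_contra hvS
    obtain ⟨D, hD, _, hDS, hn⟩ := hv S hS hvS
    exact hn (hw D hDS hD)
  have hKw : Wit G α (Ker G α) := by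
    have := key S hS
    rwa [Set.sdiff_sdiff_cancel_left hK] at this
  refine ⟨Ker G α, hS.subset hK, ?_, hKw, fun f hinj hf v hv => ker_emb hf hinj hv⟩
  by_contra hne
  rw [Set.not_nonempty_iff_eq_empty] at hne
  obtain ⟨β, hβ, hb⟩ := hKw Set.univ (by rw [hne]; simp) hc
  exact hmin β hβ hb

end RT

namespace RT

/-! ### Labelled graphs -/

structure LG (L : Type u) : Type (u + 1) where
  V : Type u
  G : SimpleGraph V
  lab : V → L

def IsEmb {L : Type u} (X Y : LG L) (f : X.V → Y.V) : Prop :=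
  Function.Injective f ∧ (∀ x y, Y.G.Adj (f x) (f y) ↔ X.G.Adj x y) ∧
    ∀ x, Y.lab (f x) = X.lab x

def Le {L : Type u} (X Y : LG L) : Prop := ∃ f, IsEmb X Y f
def Iso {L : Type u} (X Y : LG L) : Prop := ∃ f, IsEmb X Y f ∧ Function.Surjective f
def Tw {L : Type u} (X Y : LG L) : Prop := Le X Y ∧ Le Y X
def Cn {L : Type u} (X : LG L) : Prop := Conn X.G Set.univ

section basics
variable {L : Type u} {X Y Z : LG L}

theorem IsEmb.refl (X : LG L) : IsEmb X X id :=
  ⟨Function.injective_id, fun _ _ => Iff.rfl, fun _ => rfl⟩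

theorem IsEmb.comp {g : Y.V → Z.V} {f : X.V → Y.V} (hg : IsEmb Y Z g) (hf : IsEmb X Y f) :
    IsEmb X Z (g ∘ f) :=
  ⟨hg.1.comp hf.1, fun x y => (hg.2.1 _ _).trans (hf.2.1 x y),
    fun x => (hg.2.2 _).trans (hf.2.2 x)⟩

theorem IsEmb.inv {f : X.V → Y.V} (hf : IsEmb X Y f) (hs : Function.Surjective f) :
    ∃ g, IsEmb Y X g ∧ Function.Surjective g ∧ (∀ x, g (f x) = x) ∧ ∀ y, f (g y) = y := by
  let e := Equiv.ofBijective f ⟨hf.1, hs⟩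
  have h1 : ∀ x, e.symm (f x) = x := fun x => e.symm_apply_apply x
  have h2 : ∀ y, f (e.symm y) = y := fun y => e.apply_symm_apply y
  refine ⟨e.symm, ⟨e.symm.injective, fun x y => ?_, fun x => ?_⟩, e.symm.surjective, h1, h2⟩
  · rw [← hf.2.1, h2, h2]
  · rw [← hf.2.2, h2]

theorem Le.refl (X : LG L) : Le X X := ⟨id, IsEmb.refl X⟩
theorem Le.trans (h : Le X Y) (h' : Le Y Z) : Le X Z := by
  obtain ⟨f, hf⟩ := h
  obtain ⟨g, hg⟩ := h'
  exact ⟨_, hg.comp hf⟩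
theorem Iso.refl (X : LG L) : Iso X X := ⟨id, IsEmb.refl X, Function.surjective_id⟩
theorem Iso.symm (h : Iso X Y) : Iso Y X := by
  obtain ⟨f, hf, hs⟩ := h
  obtain ⟨g, hg, hgs, _⟩ := hf.inv hs
  exact ⟨g, hg, hgs⟩
theorem Iso.trans (h : Iso X Y) (h' : Iso Y Z) : Iso X Z := by
  obtain ⟨f, hf, hfs⟩ := h
  obtain ⟨g, hg, hgs⟩ := h'
  exact ⟨_, hg.comp hf, hgs.comp hfs⟩
theorem Iso.le (h : Iso X Y) : Le X Y := ⟨h.choose, h.choose_spec.1⟩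
theorem Iso.tw (h : Iso X Y) : Tw X Y := ⟨h.le, h.symm.le⟩
theorem Tw.symm (h : Tw X Y) : Tw Y X := ⟨h.2, h.1⟩
theorem Tw.trans (h : Tw X Y) (h' : Tw Y Z) : Tw X Z := ⟨h.1.trans h'.1, h'.2.trans h.2⟩

theorem Cn.all (h : Cn X) (P : X.V → Prop) (x0 : X.V) (h0 : P x0)
    (hP : ∀ a b, P a → X.G.Adj a b → P b) (x : X.V) : P x :=
  h.2 {x | P x} ⟨x0, trivial, h0⟩ (fun a _ b _ ha hab => hP a b ha hab) trivial

theorem Cn.ne (h : Cn X) : Nonempty X.V := ⟨h.1.choose⟩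

theorem cn_intro (ne : Nonempty X.V) (h : ∀ P : X.V → Prop, (∃ x, P x) →
    (∀ a b, P a → X.G.Adj a b → P b) → ∀ x, P x) : Cn X := by
  refine ⟨Set.univ_nonempty, ?_⟩
  rintro P ⟨x, _, hx⟩ hP y _
  exact h (· ∈ P) ⟨x, hx⟩ (fun a b ha hab => hP a trivial b trivial ha hab) y

theorem Cn.iso (h : Cn X) (hi : Iso X Y) : Cn Y := by
  obtain ⟨f, hf, hs⟩ := hi
  have := conn_image (fun x y hxy => (hf.2.1 x y).2 hxy) h
  rwa [Set.image_univ, hs.range_eq] at this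

end basics

/-! ### Disjoint unions -/

theorem sigma_mk_inj {I : Type u} {T : I → Type u} {i : I} {x y : T i}
    (h : (⟨i, x⟩ : Σ i, T i) = ⟨i, y⟩) : x = y := by
  cases h; rfl

section sums
variable {L : Type u} {I J : Type u}

inductive SAdj (C : I → LG L) : (Σ i, (C i).V) → (Σ i, (C i).V) → Prop
  | mk (i : I) (x y : (C i).V) (h : (C i).G.Adj x y) : SAdj C ⟨i, x⟩ ⟨i, y⟩

theorem sadj_same {C : I → LG L} {i : I} {x y : (C i).V} :
    SAdj C ⟨i, x⟩ ⟨i, y⟩ ↔ (C i).G.Adj x y := by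
  constructor
  · intro h
    cases h with
    | mk _ _ _ h => exact h
  · exact SAdj.mk i x y

theorem sadj_fst {C : I → LG L} {a b : Σ i, (C i).V} (h : SAdj C a b) : a.1 = b.1 := by
  cases h; rfl

def LG.sum (C : I → LG L) : LG L where
  V := Σ i, (C i).V
  G :=
    { Adj := SAdj C
      symm := ⟨fun a b h => by cases h with | mk i x y h => exact SAdj.mk i y x h.symm⟩
      loopless := ⟨fun a h => by
        obtain ⟨i, x⟩ := a
        exact (C i).G.loopless.irrefl x (sadj_same.1 h)⟩ }
  lab := fun a => (C a.1).lab a.2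

theorem emb_decomp {C : I → LG L} {D : J → LG L} (hC : ∀ i, Cn (C i))
    {f : (LG.sum C).V → (LG.sum D).V} (hf : IsEmb (LG.sum C) (LG.sum D) f) :
    ∃ (φ : I → J) (e : ∀ i, (C i).V → (D (φ i)).V), (∀ i, IsEmb (C i) (D (φ i)) (e i)) ∧
      ∀ i x, f ⟨i, x⟩ = ⟨φ i, e i x⟩ := by
  have h : ∀ i, ∃ (j : J) (e : (C i).V → (D j).V), IsEmb (C i) (D j) e ∧
      ∀ x, f ⟨i, x⟩ = ⟨j, e x⟩ := by
    intro i
    obtain ⟨x0⟩ := (hC i).ne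
    have h1 : ∀ x, (f ⟨i, x⟩).1 = (f ⟨i, x0⟩).1 := by
      refine (hC i).all (fun x => (f ⟨i, x⟩).1 = (f ⟨i, x0⟩).1) x0 rfl ?_
      intro a b ha hab
      exact (sadj_fst ((hf.2.1 ⟨i, a⟩ ⟨i, b⟩).2 (SAdj.mk i a b hab))).symm.trans ha
    generalize (f ⟨i, x0⟩).1 = j at h1
    have h2 : ∀ x, ∃ y : (D j).V, f ⟨i, x⟩ = ⟨j, y⟩ := by
      intro x
      have := h1 x
      generalize f ⟨i, x⟩ = p at this
      subst this
      exact ⟨p.2, rfl⟩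
    choose e he using h2
    refine ⟨j, e, ⟨?_, ?_, ?_⟩, he⟩
    · intro x y hxy
      have : f ⟨i, x⟩ = f ⟨i, y⟩ := by rw [he, he, hxy]
      exact sigma_mk_inj (hf.1 this)
    · intro x y
      have := hf.2.1 ⟨i, x⟩ ⟨i, y⟩
      rw [he, he] at this
      exact sadj_same.symm.trans (this.trans sadj_same)
    · intro x
      have := hf.2.2 ⟨i, x⟩
      rw [he] at this
      exact this
  choose φ e h1 h2 using h
  exact ⟨φ, e, h1, h2⟩

theorem isEmb_sigma {C : I → LG L} {D : J → LG L} {σ : I → J} (hσ : Function.Injective σ)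
    {e : ∀ i, (C i).V → (D (σ i)).V} (he : ∀ i, IsEmb (C i) (D (σ i)) (e i)) :
    IsEmb (LG.sum C) (LG.sum D) (fun p => ⟨σ p.1, e p.1 p.2⟩) := by
  refine ⟨?_, ?_, ?_⟩
  · exact Function.Injective.sigma_map hσ (fun i => (he i).1)
  · rintro ⟨i, x⟩ ⟨j, y⟩
    by_cases hij : i = j
    · subst hij
      exact sadj_same.trans (((he i).2.1 x y).trans sadj_same.symm)
    · exact ⟨fun h => absurd (hσ (sadj_fst h)) hij, fun h => absurd (sadj_fst h) hij⟩
  · rintro ⟨i, x⟩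
    exact (he i).2.2 x

theorem sum_mono {C : I → LG L} {D : J → LG L} (σ : I → J) (hσ : Function.Injective σ)
    (h : ∀ i, Le (C i) (D (σ i))) : Le (LG.sum C) (LG.sum D) := by
  choose e he using h
  exact ⟨_, isEmb_sigma hσ he⟩

theorem sum_iso {C : I → LG L} {D : J → LG L} (σ : I ≃ J)
    (h : ∀ i, Iso (C i) (D (σ i))) : Iso (LG.sum C) (LG.sum D) := by
  choose e he hs using h
  refine ⟨_, isEmb_sigma σ.injective he, ?_⟩
  exact Function.Surjective.sigma_map σ.surjective hs

theorem iso_decomp {C : I → LG L} {D : J → LG L} (hC : ∀ i, Cn (C i)) (hD : ∀ j, Cn (D j))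
    (h : Iso (LG.sum C) (LG.sum D)) : ∃ σ : I ≃ J, ∀ i, Iso (C i) (D (σ i)) := by
  obtain ⟨f, hf, hs⟩ := h
  obtain ⟨g, hg, -, hgf, hfg⟩ := hf.inv hs
  obtain ⟨φ, e, he, hfe⟩ := emb_decomp hC hf
  obtain ⟨ψ, e', he', hge⟩ := emb_decomp hD hg
  have h1 : ∀ i, ψ (φ i) = i := by
    intro i
    obtain ⟨x⟩ := (hC i).ne
    have := hgf ⟨i, x⟩
    rw [hfe, hge] at this
    exact congrArg Sigma.fst this
  have h2 : ∀ j, φ (ψ j) = j := by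
    intro j
    obtain ⟨x⟩ := (hD j).ne
    have := hfg ⟨j, x⟩
    rw [hge, hfe] at this
    exact congrArg Sigma.fst this
  refine ⟨⟨φ, ψ, h1, h2⟩, fun i => ⟨e i, he i, ?_⟩⟩
  intro y
  obtain ⟨⟨i', x⟩, hx⟩ := hs ⟨φ i, y⟩
  rw [hfe] at hx
  have h3 : φ i' = φ i := congrArg Sigma.fst hx
  have h4 : i' = i := by rw [← h1 i', h3, h1]
  subst h4
  exact ⟨x, sigma_mk_inj hx⟩

def ext (C : I → LG L) (c : LG L) : Option I → LG L
  | none => c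
  | some i => C i

theorem sadj_some {C : I → LG L} {c : LG L} {i j : I} {x : (C i).V} {y : (C j).V} :
    SAdj (ext C c) ⟨some i, x⟩ ⟨some j, y⟩ ↔ SAdj C ⟨i, x⟩ ⟨j, y⟩ := by
  by_cases h : i = j
  · subst h
    exact sadj_same.trans (sadj_same (C := C)).symm
  · exact ⟨fun h' => absurd (Option.some.inj (sadj_fst h')) h, fun h' => absurd (sadj_fst h') h⟩

def extMap {C : I → LG L} {D : J → LG L} (c : LG L) (f : (LG.sum C).V → (LG.sum D).V) :
    (LG.sum (ext C c)).V → (LG.sum (ext D c)).V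
  | ⟨none, x⟩ => ⟨none, x⟩
  | ⟨some i, x⟩ => ⟨some (f ⟨i, x⟩).1, (f ⟨i, x⟩).2⟩

theorem ext_mono {C : I → LG L} {D : J → LG L} (c : LG L) (h : Le (LG.sum C) (LG.sum D)) :
    Le (LG.sum (ext C c)) (LG.sum (ext D c)) := by
  obtain ⟨f, hf⟩ := h
  refine ⟨extMap c f, ?_, ?_, ?_⟩
  · rintro ⟨_ | i, x⟩ ⟨_ | j, y⟩ h
    · have h3 : x = y := sigma_mk_inj h
      rw [h3]
    · exact absurd (congrArg Sigma.fst h) (by simp [extMap])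
    · exact absurd (congrArg Sigma.fst h) (by simp [extMap])
    · have h1 : f ⟨i, x⟩ = f ⟨j, y⟩ := by
        have h3 : (⟨some (f ⟨i, x⟩).1, (f ⟨i, x⟩).2⟩ : (LG.sum (ext D c)).V) =
          ⟨some (f ⟨j, y⟩).1, (f ⟨j, y⟩).2⟩ := h
        generalize f ⟨i, x⟩ = p at h3
        generalize f ⟨j, y⟩ = q at h3
        obtain ⟨p1, p2⟩ := p
        obtain ⟨q1, q2⟩ := q
        cases h3
        rfl
      have h2 := hf.1 h1
      cases h2
      rfl
  · rintro ⟨_ | i, x⟩ ⟨_ | j, y⟩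
    · exact Iff.trans (sadj_same (C := ext D c)) (sadj_same (C := ext C c) (i := none)).symm
    · exact ⟨fun h => absurd (sadj_fst h) (by simp [extMap]),
        fun h => absurd (sadj_fst h) (by simp)⟩
    · exact ⟨fun h => absurd (sadj_fst h) (by simp [extMap]),
        fun h => absurd (sadj_fst h) (by simp)⟩
    · exact sadj_some.trans ((hf.2.1 ⟨i, x⟩ ⟨j, y⟩).trans sadj_some.symm)
  · rintro ⟨_ | i, x⟩
    · rfl
    · exact hf.2.2 ⟨i, x⟩

theorem le_ext (C : I → LG L) (c : LG L) : Le (LG.sum C) (LG.sum (ext C c)) :=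
  sum_mono some (Option.some_injective _) fun _ => Le.refl _

abbrev sub (D : J → LG L) (P : J → Prop) : {j // P j} → LG L := fun j => D j.1

def fgt {D : J → LG L} {P : J → Prop} (a : (LG.sum (sub D P)).V) : (LG.sum D).V :=
  ⟨a.1.1, a.2⟩

theorem fgt_inj {D : J → LG L} {P : J → Prop} :
    Function.Injective (fgt : (LG.sum (sub D P)).V → (LG.sum D).V) := by
  rintro ⟨⟨i, hi⟩, x⟩ ⟨⟨j, hj⟩, y⟩ h
  simp only [fgt] at h
  cases h
  rfl

theorem fgt_adj {D : J → LG L} {P : J → Prop} (a b : (LG.sum (sub D P)).V) :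
    (LG.sum D).G.Adj (fgt a) (fgt b) ↔ (LG.sum (sub D P)).G.Adj a b := by
  obtain ⟨⟨i, hi⟩, x⟩ := a
  obtain ⟨⟨j, hj⟩, y⟩ := b
  by_cases hij : i = j
  · subst hij
    exact (sadj_same (C := D)).trans (sadj_same (C := sub D P)).symm
  · exact ⟨fun h => absurd (sadj_fst h) hij,
      fun h => absurd (congrArg Subtype.val (sadj_fst h)) hij⟩

theorem sub_le {D : J → LG L} {P Q : J → Prop} (k : (LG.sum D).V → (LG.sum D).V)
    (hQ : ∀ x, P x.1 → Q (k x).1)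
    (hinj : ∀ x y, P x.1 → P y.1 → k x = k y → x = y)
    (hadj : ∀ x y, P x.1 → P y.1 → ((LG.sum D).G.Adj (k x) (k y) ↔ (LG.sum D).G.Adj x y))
    (hlab : ∀ x, P x.1 → (LG.sum D).lab (k x) = (LG.sum D).lab x) :
    Le (LG.sum (sub D P)) (LG.sum (sub D Q)) := by
  refine ⟨fun a => ⟨⟨(k (fgt a)).1, hQ (fgt a) a.1.2⟩, (k (fgt a)).2⟩, ?_, ?_, ?_⟩
  · intro a b h
    have h1 := congrArg fgt h
    exact fgt_inj (hinj _ _ a.1.2 b.1.2 h1)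
  · intro a b
    exact (fgt_adj _ _).symm.trans ((hadj _ _ a.1.2 b.1.2).trans (fgt_adj a b))
  · intro a
    exact hlab _ a.1.2

end sums

end RT

namespace RT

section fam
variable {L : Type u} {I J : Type u}

def Rigid (X : LG L) : Prop := ∀ Y, Cn Y → Tw X Y → Iso X Y
def InfTw (X : LG L) : Prop := ∃ F : ℕ → LG L, (∀ n, Cn (F n)) ∧ (∀ n, Tw X (F n)) ∧
  ∀ n m, Iso (F n) (F m) → n = m
/-- no two disjoint copies of `X` in `X` -/
def NonDouble (X : LG L) : Prop := ∀ f g, IsEmb X X f → IsEmb X X g → ∃ x y, f x = g y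

def InfFam (Q : LG L → Prop) (C : I → LG L) : Prop :=
  ∃ F : ℕ → Σ I' : Type u, I' → LG L, (∀ n i, Q ((F n).2 i)) ∧
    (∀ n, Tw (LG.sum C) (LG.sum (F n).2)) ∧
    ∀ n m, Iso (LG.sum (F n).2) (LG.sum (F m).2) → n = m

theorem InfFam.transfer {Q : LG L → Prop} {C : I → LG L} {D : J → LG L}
    (h : InfFam Q D) (ht : Tw (LG.sum C) (LG.sum D)) : InfFam Q C := by
  obtain ⟨F, h1, h2, h3⟩ := h
  exact ⟨F, h1, fun n => ht.trans (h2 n), h3⟩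

theorem caseA {Q : LG L → Prop} (hQc : ∀ X, Q X → Cn X)
    (hQ : ∀ X Y, Q X → Cn Y → Le X Y → Q Y) {C : I → LG L} (hC : ∀ i, Q (C i)) (i0 : I)
    (hi : InfTw (C i0)) : InfFam Q C := by
  classical
  obtain ⟨T, hTc, hT, hTi⟩ := hi
  let F : ℕ → I → LG L := fun n i => if Tw (C i0) (C i) then T n else C i
  have hF1 : ∀ n i, Tw (C i0) (C i) → F n i = T n := fun n i h => if_pos h
  have hF2 : ∀ n i, ¬ Tw (C i0) (C i) → F n i = C i := fun n i h => if_neg h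
  have hFt : ∀ n i, Tw (C i) (F n i) := by
    intro n i
    by_cases h : Tw (C i0) (C i)
    · rw [hF1 n i h]; exact h.symm.trans (hT n)
    · rw [hF2 n i h]; exact ⟨Le.refl _, Le.refl _⟩
  have hFQ : ∀ n i, Q (F n i) := by
    intro n i
    by_cases h : Tw (C i0) (C i)
    · rw [hF1 n i h]; exact hQ _ _ (hC i0) (hTc n) (hT n).1
    · rw [hF2 n i h]; exact hC i
  refine ⟨fun n => ⟨I, F n⟩, hFQ, fun n => ⟨?_, ?_⟩, ?_⟩
  · exact sum_mono id Function.injective_id fun i => (hFt n i).1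
  · exact sum_mono id Function.injective_id fun i => (hFt n i).2
  · intro n m h
    obtain ⟨σ, hσ⟩ := iso_decomp (fun i => hQc _ (hFQ n i)) (fun i => hQc _ (hFQ m i)) h
    have h0 := hσ i0
    have ht0 : Tw (C i0) (C i0) := ⟨Le.refl _, Le.refl _⟩
    have ht : Tw (C i0) (C (σ i0)) :=
      (hFt n i0).trans (h0.tw.trans (hFt m (σ i0)).symm)
    have h0 : Iso (F n i0) (F m (σ i0)) := h0
    rw [hF1 n i0 ht0, hF1 m _ ht] at h0
    exact hTi _ _ h0

def growFam (D : J → LG L) (c : LG L) : ℕ → Σ I' : Type u, I' → LG L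
  | 0 => ⟨J, D⟩
  | n + 1 => ⟨Option (growFam D c n).1, ext (growFam D c n).2 c⟩

theorem grow {Q : LG L → Prop} (hQc : ∀ X, Q X → Cn X) {D : J → LG L} (hD : ∀ j, Q (D j))
    {c : LG L} (hc : Q c) (hno : ∀ j, ¬ Iso (D j) c)
    (hle : Le (LG.sum (ext D c)) (LG.sum D)) : InfFam Q D := by
  have hQF : ∀ n i, Q ((growFam D c n).2 i) := by
    intro n
    induction n with
    | zero => exact hD
    | succ n ih =>
      rintro (_ | i)
      · exact hc
      · exact ih i
  have h1 : ∀ n, Le (LG.sum D) (LG.sum (growFam D c n).2) := by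
    intro n
    induction n with
    | zero => exact Le.refl _
    | succ n ih => exact ih.trans (le_ext _ c)
  have h2 : ∀ n, Le (LG.sum (growFam D c n).2) (LG.sum D) := by
    intro n
    induction n with
    | zero => exact Le.refl _
    | succ n ih => exact (ext_mono c ih).trans hle
  have h3 : ∀ n, {i | Iso ((growFam D c n).2 i) c}.Finite ∧
      {i | Iso ((growFam D c n).2 i) c}.ncard = n := by
    intro n
    induction n with
    | zero =>
      have : {i | Iso ((growFam D c 0).2 i) c} = ∅ := by
        ext i; exact ⟨fun h => hno i h, fun h => h.elim⟩
      rw [this]; simp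
    | succ n ih =>
      have : {i | Iso ((growFam D c (n + 1)).2 i) c} =
          insert none (some '' {i | Iso ((growFam D c n).2 i) c}) := by
        apply Set.ext
        rintro (_ | i)
        · exact ⟨fun _ => Or.inl rfl, fun _ => Iso.refl c⟩
        · constructor
          · intro h
            exact Or.inr ⟨i, h, rfl⟩
          · rintro (h | ⟨i', h, h'⟩)
            · cases h
            · cases h'; exact h
      have hfi := ih.1.image some
      refine ⟨by rw [this]; exact hfi.insert _, ?_⟩
      have hn : (insert none (some '' {i | Iso ((growFam D c n).2 i) c})).ncard = n + 1 := by
        rw [Set.ncard_insert_of_notMem (by simp) hfi,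
          Set.ncard_image_of_injective _ (Option.some_injective _), ih.2]
      rw [this]
      exact hn
  refine ⟨growFam D c, hQF, fun n => ⟨h1 n, h2 n⟩, fun n m h => ?_⟩
  obtain ⟨σ, hσ⟩ := iso_decomp (fun i => hQc _ (hQF n i)) (fun i => hQc _ (hQF m i)) h
  rw [← (h3 n).2, ← (h3 m).2]
  have : {i | Iso ((growFam D c m).2 i) c} = σ '' {i | Iso ((growFam D c n).2 i) c} := by
    apply Set.ext
    intro i
    constructor
    · intro hi
      refine ⟨σ.symm i, ?_, by simp⟩
      have := hσ (σ.symm i)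
      rw [σ.apply_symm_apply] at this
      exact this.trans hi
    · rintro ⟨i', h, rfl⟩
      exact (hσ i').symm.trans h
  rw [this, Set.ncard_image_of_injective _ σ.injective]

theorem core {Q : LG L → Prop} (hQc : ∀ X, Q X → Cn X)
    (hQ : ∀ X Y, Q X → Cn Y → Le X Y → Q Y) {C : I → LG L} {D : J → LG L}
    (hC : ∀ i, Q (C i)) (hD : ∀ j, Q (D j)) (rC : ∀ i, Rigid (C i))
    (hnd : ∀ j, NonDouble (D j))
    (ht : Tw (LG.sum C) (LG.sum D)) (c : LG L)
    (hinj : ¬ Nonempty ({j // Iso (D j) c} ↪ {i // Iso (C i) c})) : InfFam Q D := by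
  classical
  obtain ⟨⟨f, hf⟩, ⟨g, hg⟩⟩ := ht
  obtain ⟨γ, eg, heg, hge⟩ := emb_decomp (fun j => hQc _ (hD j)) hg
  obtain ⟨δ, ef, hef, hfe⟩ := emb_decomp (fun i => hQc _ (hC i)) hf
  let h := f ∘ g
  have hh : IsEmb _ _ h := hf.comp hg
  let φ : J → J := fun j => δ (γ j)
  have hφ : ∀ x, (h x).1 = φ x.1 := by
    rintro ⟨j, x⟩
    show (f (g ⟨j, x⟩)).1 = _
    rw [hge, hfe]
  let B : Set J := {j | Iso (D j) c}
  let B' : Set J := {j | j ∈ B ∧ ¬ Iso (C (γ j)) c}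
  -- the remaining copies of `c` inject
  have inj1 : ∀ j j', j ∈ B → j' ∈ B → Iso (C (γ j)) c → γ j = γ j' → j = j' := by
    intro j j' hj hj' hi hjj
    by_contra hne
    have i1 : Iso (D j) (D j') := Iso.trans hj (Iso.symm hj')
    obtain ⟨a, ha, has⟩ := i1
    have i2 : Iso (C (γ j)) (D j) := hi.trans (Iso.symm hj)
    obtain ⟨b, hb, hbs⟩ := i2
    -- two embeddings of D j in C (γ j)
    have e2 : ∃ e' : (D j').V → (C (γ j)).V, IsEmb _ _ e' ∧ ∀ x, g ⟨j', x⟩ = ⟨γ j, e' x⟩ := by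
      have := hge j'
      have h2 := heg j'
      generalize eg j' = q at this h2
      revert q
      rw [← hjj]
      intro q h1 h2
      exact ⟨q, h2, h1⟩
    obtain ⟨e', he', hge'⟩ := e2
    obtain ⟨x, y, hxy⟩ := hnd j (b ∘ eg j) (b ∘ (e' ∘ a)) (hb.comp (heg j)) (hb.comp (he'.comp ha))
    have h4 : eg j x = e' (a y) := hb.1 hxy
    have h5 : g ⟨j, x⟩ = g ⟨j', a y⟩ := by rw [hge, hge', h4]
    exact hne (congrArg Sigma.fst (hg.1 h5))
  have leC : ∀ j ∈ B', ∀ n, Le (C (γ j)) (D (φ^[n + 1] j)) := by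
    intro j _ n
    induction n with
    | zero => exact ⟨_, hef (γ j)⟩
    | succ n ih =>
      rw [Function.iterate_succ_apply']
      exact ih.trans (Le.trans ⟨_, heg _⟩ ⟨_, hef _⟩)
  have notB : ∀ j ∈ B', ∀ n, φ^[n + 1] j ∉ B := by
    intro j hj n hB
    have h1 : Le (C (γ j)) c := (leC j hj n).trans (Iso.le hB)
    have h2 : Le c (C (γ j)) := (Iso.le (Iso.symm hj.1)).trans ⟨_, heg j⟩
    exact hj.2 (rC _ _ ((hQc _ (hD j)).iso hj.1) ⟨h1, h2⟩)
  let U : Set J := {k | ∃ j ∈ B', ∃ n, k = φ^[n] j}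
  have hU0 : B' ⊆ U := fun j hj => ⟨j, hj, 0, rfl⟩
  have hUφ : ∀ k ∈ U, φ k ∈ U ∧ φ k ∉ B := by
    rintro k ⟨j, hj, n, rfl⟩
    have : φ (φ^[n] j) = φ^[n + 1] j := (Function.iterate_succ_apply' _ _ _).symm
    rw [this]
    exact ⟨⟨j, hj, n + 1, rfl⟩, notB j hj n⟩
  let k : (LG.sum D).V → (LG.sum D).V := fun x => if x.1 ∈ U then h x else x
  have k1 : ∀ x, x.1 ∈ U → k x = h x := fun x hx => if_pos hx
  have k2 : ∀ x, x.1 ∉ U → k x = x := fun x hx => if_neg hx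
  have k3 : ∀ x, x.1 ∈ U → (h x).1 ∈ U := fun x hx => by rw [hφ]; exact (hUφ _ hx).1
  have main : Le (LG.sum (sub D fun j => j ∉ B ∨ j ∈ B')) (LG.sum (sub D fun j => j ∉ B)) := by
    refine sub_le k ?_ ?_ ?_ ?_
    · intro x hx
      by_cases hxU : x.1 ∈ U
      · rw [k1 x hxU, hφ]; exact (hUφ _ hxU).2
      · rw [k2 x hxU]
        exact hx.resolve_right fun h => hxU (hU0 h)
    · intro x y _ _ hxy
      by_cases hx : x.1 ∈ U <;> by_cases hy : y.1 ∈ U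
      · rw [k1 x hx, k1 y hy] at hxy; exact hh.1 hxy
      · rw [k1 x hx, k2 y hy] at hxy
        exact absurd (hxy ▸ k3 x hx) hy
      · rw [k2 x hx, k1 y hy] at hxy
        exact absurd (hxy.symm ▸ k3 y hy) hx
      · rwa [k2 x hx, k2 y hy] at hxy
    · intro x y _ _
      by_cases hx : x.1 ∈ U <;> by_cases hy : y.1 ∈ U
      · rw [k1 x hx, k1 y hy]; exact hh.2.1 x y
      · rw [k1 x hx, k2 y hy]
        constructor
        · intro h; exact absurd (sadj_fst h ▸ k3 x hx) hy
        · intro h; exact absurd (sadj_fst h ▸ hx) hy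
      · rw [k2 x hx, k1 y hy]
        constructor
        · intro h; exact absurd ((sadj_fst h).symm ▸ k3 y hy) hx
        · intro h; exact absurd ((sadj_fst h).symm ▸ hy) hx
      · rw [k2 x hx, k2 y hy]
    · intro x _
      by_cases hx : x.1 ∈ U
      · rw [k1 x hx]; exact hh.2.2 x
      · rw [k2 x hx]
  -- `B'` is nonempty
  have hne : ∃ j0, j0 ∈ B' := by
    by_contra hcon
    push Not at hcon
    have hall : ∀ j ∈ B, Iso (C (γ j)) c := fun j hj => by
      by_contra hi
      exact hcon j ⟨hj, hi⟩
    exact hinj ⟨⟨fun j => ⟨γ j.1, hall j.1 j.2⟩, fun a b hab =>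
      Subtype.ext (inj1 _ _ a.2 b.2 (hall _ a.2) (congrArg Subtype.val hab))⟩⟩
  obtain ⟨j0, hj0⟩ := hne
  have hcQ : Q c := hQ _ _ (hD j0) ((hQc _ (hD j0)).iso hj0.1) (Iso.le hj0.1)
  have hext : Le (LG.sum (ext (sub D fun j => j ∉ B) c)) (LG.sum (sub D fun j => j ∉ B)) := by
    refine Le.trans ?_ main
    refine sum_mono (fun o => match o with
      | none => ⟨j0, Or.inr hj0⟩
      | some j => ⟨j.1, Or.inl j.2⟩) ?_ ?_
    · rintro (_ | i) (_ | j) hij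
      · rfl
      · exact absurd (congrArg Subtype.val hij ▸ hj0.1) j.2
      · exact absurd ((congrArg Subtype.val hij).symm ▸ hj0.1) i.2
      · have : i.1 = j.1 := (Subtype.ext_iff.1 hij :)
        rw [Subtype.ext this]
    · rintro (_ | i)
      · exact Iso.le (Iso.symm hj0.1)
      · exact Le.refl _
  have hdown : Le (LG.sum D) (LG.sum (sub D fun j => j ∉ B)) := by
    by_cases hfin : B.Finite
    · have key : ∀ A : Set J, A.Finite → A ⊆ B →
          Le (LG.sum (sub D fun j => j ∉ B ∨ j ∈ A)) (LG.sum (sub D fun j => j ∉ B)) := by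
        intro A hA
        induction A, hA using Set.Finite.induction_on with
        | empty =>
          intro _
          refine sum_mono (fun j => ⟨j.1, j.2.resolve_right fun h => h.elim⟩) ?_ ?_
          · intro a b hab
            have q := Subtype.ext_iff.1 hab
            exact Subtype.ext q
          · intro i; exact Le.refl _
        | @insert a A _ _ ih =>
          intro hAB
          refine Le.trans ?_ ((ext_mono c (ih fun x hx => hAB (Or.inr hx))).trans hext)
          refine sum_mono (fun j => if hj : j.1 = a then none else
            some ⟨j.1, j.2.imp id fun h => h.resolve_left hj⟩) ?_ ?_
          · intro x y hxy
            by_cases hx : x.1 = a <;> by_cases hy : y.1 = a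
            · exact Subtype.ext (hx.trans hy.symm)
            · simp [hx, hy] at hxy
            · simp [hx, hy] at hxy
            · simp only [hx, hy, dite_false] at hxy
              have q := Subtype.ext_iff.1 (Option.some.inj hxy)
              exact Subtype.ext q
          · intro x
            by_cases hx : x.1 = a
            · simp only [hx, dite_true]
              have : Iso (D a) c := hAB (Or.inl rfl)
              rw [← hx] at this
              exact this.le
            · simp only [hx, dite_false]
              exact Le.refl _
      refine Le.trans ?_ (key B hfin subset_rfl)
      exact sum_mono (fun j => ⟨j, (em (j ∈ B)).symm⟩)
        (fun a b hab => congrArg Subtype.val hab) fun i => Le.refl _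
    · have hcard : Nonempty (B ↪ B') := by
        by_contra hcon
        have hinf : Infinite B := Set.infinite_coe_iff.2 hfin
        let S : Set B := {j | j.1 ∈ B'}
        have hS : Cardinal.mk S < Cardinal.mk B := by
          by_contra hle
          rw [not_lt, Cardinal.le_def] at hle
          obtain ⟨e⟩ := hle
          exact hcon ⟨⟨fun j => ⟨(e j).1.1, (e j).2⟩, fun a b hab =>
            e.injective (Subtype.ext (Subtype.ext (Subtype.ext_iff.1 hab :)))⟩⟩
        have h1 := (Cardinal.mk_compl_of_infinite S hS).ge
        rw [Cardinal.le_def] at h1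
        obtain ⟨e⟩ := h1
        have hall : ∀ j : (Sᶜ : Set B), Iso (C (γ j.1.1)) c := fun j => by
          by_contra hi
          exact j.2 ⟨j.1.2, hi⟩
        exact hinj ⟨⟨fun j => ⟨γ (e j).1.1, hall (e j)⟩, fun a b hab =>
          e.injective (Subtype.ext (Subtype.ext (inj1 _ _ (e a).1.2 (e b).1.2 (hall (e a))
            (congrArg Subtype.val hab))))⟩⟩
      obtain ⟨e⟩ := hcard
      refine Le.trans ?_ main
      refine sum_mono (fun j => if hj : j ∈ B then ⟨(e ⟨j, hj⟩).1, Or.inr (e ⟨j, hj⟩).2⟩ else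
        ⟨j, Or.inl hj⟩) ?_ ?_
      · intro x y hxy
        by_cases hx : x ∈ B <;> by_cases hy : y ∈ B
        · simp only [hx, hy, dite_true] at hxy
          have := e.injective (Subtype.ext (Subtype.ext_iff.1 hxy :))
          exact congrArg Subtype.val this
        · simp only [hx, hy, dite_true, dite_false] at hxy
          have q : (e ⟨x, hx⟩).1 = y := Subtype.ext_iff.1 hxy
          exact absurd (q ▸ (e ⟨x, hx⟩).2.1) hy
        · simp only [hx, hy, dite_true, dite_false] at hxy
          have q : x = (e ⟨y, hy⟩).1 := Subtype.ext_iff.1 hxy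
          exact absurd (q ▸ (e ⟨y, hy⟩).2.1) hx
        · simp only [hx, hy, dite_false] at hxy
          exact congrArg Subtype.val hxy
      · intro x
        by_cases hx : x ∈ B
        · simp only [hx, dite_true]
          exact (Iso.le hx).trans (Iso.le (Iso.symm (e ⟨x, hx⟩).2.1))
        · simp only [hx, dite_false]
          exact Le.refl _
  have hup : Le (LG.sum (sub D fun j => j ∉ B)) (LG.sum D) :=
    sum_mono (fun j => j.1) Subtype.val_injective fun i => Le.refl _
  exact (grow (D := sub D fun j => j ∉ B) hQc (fun j => hD j.1) hcQ (fun j => j.2) hext).transfer ⟨hdown, hup⟩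

theorem family {Q : LG L → Prop} (hQc : ∀ X, Q X → Cn X)
    (hQ : ∀ X Y, Q X → Cn Y → Le X Y → Q Y) {C : I → LG L} {D : J → LG L}
    (hC : ∀ i, Q (C i)) (hD : ∀ j, Q (D j))
    (tC : ∀ i, Rigid (C i) ∨ InfTw (C i)) (tD : ∀ j, Rigid (D j) ∨ InfTw (D j))
    (nC : ∀ i, NonDouble (C i)) (nD : ∀ j, NonDouble (D j))
    (ht : Tw (LG.sum C) (LG.sum D)) (hni : ¬ Iso (LG.sum C) (LG.sum D)) : InfFam Q C := by
  by_cases h1 : ∃ i, InfTw (C i)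
  · obtain ⟨i, hi⟩ := h1
    exact caseA hQc hQ hC i hi
  by_cases h2 : ∃ j, InfTw (D j)
  · obtain ⟨i, hi⟩ := h2
    exact (caseA hQc hQ hD i hi).transfer ht
  have rC : ∀ i, Rigid (C i) := fun i => (tC i).resolve_right fun h => h1 ⟨i, h⟩
  have rD : ∀ i, Rigid (D i) := fun i => (tD i).resolve_right fun h => h2 ⟨i, h⟩
  by_cases h3 : ∃ c : LG L, ¬ Nonempty ({j // Iso (D j) c} ↪ {i // Iso (C i) c})
  · obtain ⟨c, hc⟩ := h3
    exact (core hQc hQ hC hD rC nD ht c hc).transfer ht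
  by_cases h4 : ∃ c : LG L, ¬ Nonempty ({i // Iso (C i) c} ↪ {j // Iso (D j) c})
  · obtain ⟨c, hc⟩ := h4
    exact core hQc hQ hD hC rD nC ht.symm c hc
  exfalso
  push Not at h3 h4
  apply hni
  let st : Setoid (LG L) := ⟨Iso, Iso.refl, Iso.symm, Iso.trans⟩
  have hq : ∀ q : Quotient st, Nonempty ({i // Quotient.mk st (C i) = q} ≃
      {j // Quotient.mk st (D j) = q}) := by
    intro q
    induction q using Quotient.inductionOn with
    | h c =>
      obtain ⟨a⟩ := h3 c
      obtain ⟨b⟩ := h4 c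
      obtain ⟨e⟩ := Function.Embedding.antisymm b a
      exact ⟨(Equiv.subtypeEquivRight fun i => Quotient.eq (r := st)).trans
        (e.trans (Equiv.subtypeEquivRight fun j => (Quotient.eq (r := st)).symm))⟩
  let e := fun q => (hq q).some
  refine sum_iso (Equiv.ofFiberEquiv e) fun i => ?_
  have := Equiv.ofFiberEquiv_map (f := fun i => Quotient.mk st (C i))
    (g := fun j => Quotient.mk st (D j)) e i
  exact Iso.symm (Quotient.exact this)

end fam
end RT

namespace RT

section build
variable {L : Type u} {κ : Type u}

def bAdj (K0 : SimpleGraph κ) (Z : LG (L × Set κ)) : κ ⊕ Z.V → κ ⊕ Z.V → Prop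
  | .inl a, .inl b => K0.Adj a b
  | .inl a, .inr z => a ∈ (Z.lab z).2
  | .inr z, .inl a => a ∈ (Z.lab z).2
  | .inr z, .inr w => Z.G.Adj z w

/-- The graph obtained from a core `K0` and a labelled graph `Z`, whose labels say how it is
attached to the core. -/
def build (K0 : SimpleGraph κ) (kl : κ → L) (Z : LG (L × Set κ)) : LG L where
  V := κ ⊕ Z.V
  G :=
    { Adj := bAdj K0 Z
      symm := ⟨by
        rintro (a | z) (b | w) h
        · exact K0.symm.symm _ _ h
        · exact h
        · exact h
        · exact Z.G.symm.symm _ _ h⟩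
      loopless := ⟨by
        rintro (a | z) h
        · exact K0.loopless.irrefl a h
        · exact Z.G.loopless.irrefl z h⟩ }
  lab := Sum.elim kl fun z => (Z.lab z).1

def rest (X : LG L) (k : κ → X.V) : LG (L × Set κ) where
  V := {x // x ∉ Set.range k}
  G := X.G.comap Subtype.val
  lab := fun x => (X.lab x.1, {a | X.G.Adj (k a) x.1})

theorem build_iso (X : LG L) (k : κ → X.V) (hk : Function.Injective k) (K0 : SimpleGraph κ)
    (kl : κ → L) (h0 : ∀ a b, X.G.Adj (k a) (k b) ↔ K0.Adj a b) (hl : ∀ a, X.lab (k a) = kl a) :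
    ∃ f, IsEmb (build K0 kl (rest X k)) X f ∧ Function.Surjective f ∧
      ∀ a, f (.inl a) = k a := by
  refine ⟨Sum.elim k Subtype.val, ⟨?_, ?_, ?_⟩, ?_, fun a => rfl⟩
  · rintro (a | z) (b | w) h
    · exact congrArg Sum.inl (hk h)
    · exact absurd ⟨a, h⟩ w.2
    · exact absurd ⟨b, h.symm⟩ z.2
    · exact congrArg Sum.inr (Subtype.ext h)
  · rintro (a | z) (b | w)
    · exact h0 a b
    · exact Iff.rfl
    · exact X.G.adj_comm _ _
    · exact Iff.rfl
  · rintro (a | z)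
    · exact hl a
    · rfl
  · intro x
    by_cases hx : x ∈ Set.range k
    · obtain ⟨a, rfl⟩ := hx
      exact ⟨.inl a, rfl⟩
    · exact ⟨.inr ⟨x, hx⟩, rfl⟩

variable {K0 : SimpleGraph κ} {kl : κ → L} {Z Z' : LG (L × Set κ)}

theorem build_emb {e : Z.V → Z'.V} (he : IsEmb Z Z' e) :
    IsEmb (build K0 kl Z) (build K0 kl Z') (Sum.map id e) := by
  refine ⟨Function.injective_id.sumMap he.1, ?_, ?_⟩
  · rintro (a | z) (b | w)
    · exact Iff.rfl
    · show a ∈ (Z'.lab (e w)).2 ↔ a ∈ (Z.lab w).2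
      rw [he.2.2]
    · show b ∈ (Z'.lab (e z)).2 ↔ b ∈ (Z.lab z).2
      rw [he.2.2]
    · exact he.2.1 z w
  · rintro (a | z)
    · rfl
    · show (Z'.lab (e z)).1 = (Z.lab z).1
      rw [he.2.2]

theorem build_le (h : Le Z Z') : ∃ f, IsEmb (build K0 kl Z) (build K0 kl Z') f ∧
    ∀ a, f (.inl a) = .inl a := by
  obtain ⟨e, he⟩ := h
  exact ⟨_, build_emb he, fun a => rfl⟩

theorem build_iso' (h : Iso Z Z') : ∃ f, IsEmb (build K0 kl Z) (build K0 kl Z') f ∧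
    Function.Surjective f ∧ ∀ a, f (.inl a) = .inl a := by
  obtain ⟨e, he, hs⟩ := h
  exact ⟨_, build_emb he, Function.surjective_id.sumMap hs, fun a => rfl⟩

theorem build_rest {f : (build K0 kl Z).V → (build K0 kl Z').V}
    (hf : IsEmb (build K0 kl Z) (build K0 kl Z') f) (h0 : ∀ a, f (.inl a) = .inl a) :
    ∃ e, IsEmb Z Z' e ∧ ∀ z, f (.inr z) = .inr (e z) := by
  have h : ∀ z : Z.V, ∃ w : Z'.V, f (.inr z) = .inr w := by
    intro z
    rcases hz : f (.inr z) with a | w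
    · have := hf.1 (hz.trans (h0 a).symm)
      cases this
    · exact ⟨w, rfl⟩
  choose e he using h
  refine ⟨e, ⟨?_, ?_, ?_⟩, he⟩
  · intro x y hxy
    have : f (.inr x) = f (.inr y) := by rw [he, he, hxy]
    exact Sum.inr.inj (hf.1 this)
  · intro x y
    have := hf.2.1 (.inr x) (.inr y)
    rw [he, he] at this
    exact this
  · intro x
    apply Prod.ext
    · have := hf.2.2 (.inr x)
      rw [he] at this
      exact this
    · ext a
      have := hf.2.1 (.inl a) (.inr x)
      rw [he, h0] at this
      exact this

theorem build_rest_le {f : (build K0 kl Z).V → (build K0 kl Z').V}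
    (hf : IsEmb (build K0 kl Z) (build K0 kl Z') f) (h0 : ∀ a, f (.inl a) = .inl a) :
    Le Z Z' := by
  obtain ⟨e, he, _⟩ := build_rest hf h0
  exact ⟨e, he⟩

theorem build_rest_iso {f : (build K0 kl Z).V → (build K0 kl Z').V}
    (hf : IsEmb (build K0 kl Z) (build K0 kl Z') f) (hs : Function.Surjective f)
    (h0 : ∀ a, f (.inl a) = .inl a) : Iso Z Z' := by
  obtain ⟨e, he, h⟩ := build_rest hf h0
  refine ⟨e, he, fun w => ?_⟩
  obtain ⟨a | z, hx⟩ := hs (.inr w)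
  · rw [h0] at hx
    cases hx
  · rw [h] at hx
    exact ⟨z, Sum.inr.inj hx⟩

theorem exists_comps {M : Type u} (Z : LG M) :
    ∃ (I : Type u) (C : I → LG M), (∀ i, Cn (C i)) ∧ Iso (LG.sum C) Z := by
  let C : Z.G.ConnectedComponent → LG M := fun k =>
    ⟨{z // Z.G.connectedComponentMk z = k}, Z.G.comap Subtype.val, fun z => Z.lab z.1⟩
  refine ⟨Z.G.ConnectedComponent, C, ?_, fun p => p.2.1, ⟨?_, ?_, ?_⟩, ?_⟩
  · intro k
    obtain ⟨z0, hz0⟩ := k.exists_rep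
    refine cn_intro ⟨⟨z0, hz0⟩⟩ ?_
    rintro P ⟨⟨x, hx⟩, hPx⟩ hP ⟨y, hy⟩
    have hr : Z.G.Reachable x y := SimpleGraph.ConnectedComponent.exact (hx.trans hy.symm)
    obtain ⟨w⟩ := hr
    induction w with
    | nil => exact hPx
    | @cons a b c hab w ih =>
      have hb : Z.G.connectedComponentMk b = k := by
        rw [← hx]
        exact (SimpleGraph.ConnectedComponent.sound hab.reachable).symm
      exact ih hb (hP ⟨a, hx⟩ ⟨b, hb⟩ hPx hab) hy
  · rintro ⟨i, ⟨x, rfl⟩⟩ ⟨j, ⟨y, rfl⟩⟩ h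
    have h : x = y := h
    subst h
    rfl
  · rintro ⟨i, ⟨x, rfl⟩⟩ ⟨j, ⟨y, hy⟩⟩
    constructor
    · intro h
      have h : Z.G.Adj x y := h
      have : Z.G.connectedComponentMk x = j := by
        rw [← hy]
        exact SimpleGraph.ConnectedComponent.sound h.reachable
      subst this
      exact SAdj.mk (C := C) _ ⟨x, rfl⟩ ⟨y, hy⟩ h
    · intro h
      have h1 := sadj_fst h
      have h1 : Z.G.connectedComponentMk x = j := h1
      subst h1
      exact (sadj_same (C := C) (i := Z.G.connectedComponentMk x) (x := ⟨x, rfl⟩)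
        (y := ⟨y, hy⟩)).1 h
  · rintro ⟨i, x⟩
    rfl
  · intro z
    exact ⟨⟨_, ⟨z, rfl⟩⟩, rfl⟩

/-- attached to the core -/
def Att (W : LG (L × Set κ)) : Prop := Cn W ∧ ∃ w, (W.lab w).2.Nonempty

theorem att_mono (X Y : LG (L × Set κ)) (hX : Att X) (hY : Cn Y) (h : Le X Y) : Att Y := by
  obtain ⟨f, hf⟩ := h
  obtain ⟨_, w, hw⟩ := hX
  exact ⟨hY, f w, by rwa [hf.2.2]⟩

theorem att_of_build {I : Type u} {C : I → LG (L × Set κ)} (ne : Nonempty κ)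
    (h : Cn (build K0 kl (LG.sum C))) (i : I) (hi : Cn (C i)) : Att (C i) := by
  refine ⟨hi, ?_⟩
  by_contra hcon
  push Not at hcon
  obtain ⟨x0⟩ := hi.ne
  obtain ⟨a⟩ := ne
  have := h.all (fun v => ∃ x, v = .inr ⟨i, x⟩) (.inr ⟨i, x0⟩) ⟨x0, rfl⟩ (by
    rintro _ b ⟨x, rfl⟩ hb
    rcases b with b | ⟨j, y⟩
    · have hb : b ∈ ((C i).lab x).2 := hb
      rw [hcon x] at hb
      exact hb.elim
    · have hb : SAdj C ⟨i, x⟩ ⟨j, y⟩ := hb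
      have := sadj_fst hb
      have : i = j := this
      subst this
      exact ⟨y, rfl⟩) (.inl a)
  obtain ⟨x, hx⟩ := this
  cases hx

theorem build_cn {X : LG L} (hX : Cn X) {I : Type u} {C : I → LG (L × Set κ)} (ne : Nonempty κ)
    (hC : ∀ i, Att (C i)) (k : κ → X.V) (s : X.V → (build K0 kl (LG.sum C)).V)
    (hs : IsEmb X (build K0 kl (LG.sum C)) s) (hk : ∀ a, s (k a) = .inl a) :
    Cn (build K0 kl (LG.sum C)) := by
  obtain ⟨a0⟩ := ne
  refine cn_intro ⟨.inl a0⟩ ?_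
  rintro P ⟨v, hv⟩ hP
  have hi : ∀ i x y, P (.inr ⟨i, x⟩) → P (.inr ⟨i, y⟩) := by
    intro i x y hx
    exact (hC i).1.all (fun y => P (.inr ⟨i, y⟩)) x hx
      (fun a b ha hab => hP _ _ ha (SAdj.mk i a b hab)) y
  have h1 : ∃ a, P (.inl a) := by
    rcases v with a | ⟨i, x⟩
    · exact ⟨a, hv⟩
    · obtain ⟨_, w, a, ha⟩ := hC i
      exact ⟨a, hP _ _ (hi i x w hv) ha⟩
  obtain ⟨a, ha⟩ := h1
  have h2 : ∀ x, P (s x) := by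
    refine hX.all (fun x => P (s x)) (k a) (by rw [hk]; exact ha) ?_
    intro x y hx hxy
    exact hP _ _ hx ((hs.2.1 x y).2 hxy)
  have h3 : ∀ b, P (.inl b) := fun b => by rw [← hk]; exact h2 _
  rintro (b | ⟨i, x⟩)
  · exact h3 b
  · obtain ⟨_, w, a, ha⟩ := hC i
    exact hi i w x (hP (.inl a) _ (h3 a) ha)

end build

theorem IsEmb.iterate {L : Type u} {X : LG L} {p : X.V → X.V} (hp : IsEmb X X p) (n : ℕ) :
    IsEmb X X p^[n] := by
  induction n with
  | zero => exact IsEmb.refl X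
  | succ n ih => rw [Function.iterate_succ']; exact hp.comp ih

theorem infTw_of_seq {L : Type u} {X : LG L} (F : ℕ → LG L) (hc : ∀ n, Cn (F n))
    (ht : ∀ n, Tw X (F n)) (hfin : ∀ n, {m | Iso (F m) (F n)}.Finite) : InfTw X := by
  let st : Setoid ℕ := ⟨fun n m => Iso (F n) (F m), fun n => Iso.refl _, Iso.symm, Iso.trans⟩
  have : Infinite (Quotient st) := by
    by_contra hni
    rw [not_infinite_iff_finite] at hni
    obtain ⟨y, hy⟩ := Finite.exists_infinite_fiber (Quotient.mk st)
    obtain ⟨n, rfl⟩ := Quotient.exists_rep y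
    refine (Set.infinite_coe_iff.1 hy) ((hfin n).subset ?_)
    intro m hm
    exact Quotient.exact hm
  let e := Infinite.natEmbedding (Quotient st)
  refine ⟨fun k => F (e k).out, fun k => hc _, fun k => ht _, fun k l h => ?_⟩
  apply e.injective
  rw [← Quotient.out_eq (e k), ← Quotient.out_eq (e l)]
  exact Quotient.sound h

theorem step {α : Ordinal.{u}}
    (IH : ∀ β < α, ∀ (L : Type u) (X : LG L), Cn X → HasRk X.G β Set.univ →
      (Rigid X ∨ InfTw X) ∧ NonDouble X)
    {L : Type u} (X : LG L) (hX : Cn X) (hr : HasRk X.G α Set.univ)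
    (hmin : ∀ β < α, ¬ HasRk X.G β Set.univ) : (Rigid X ∨ InfTw X) ∧ NonDouble X := by
  obtain ⟨K, hKf, hKn, hKw, hKe⟩ := exists_kernel hX hr hmin
  have hK : ∀ f, IsEmb X X f → ∀ v ∈ K, f v ∈ K := fun f hf =>
    hKe f hf.1 fun x y h => (hf.2.1 x y).2 h
  have finK : Finite K := hKf
  have neK : Nonempty K := hKn.to_subtype
  have hbij : ∀ f, ∀ hf : IsEmb X X f, Function.Bijective
      (fun a : K => (⟨f a.1, hK f hf a.1 a.2⟩ : K)) := by
    intro f hf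
    have : Function.Injective (fun a : K => (⟨f a.1, hK f hf a.1 a.2⟩ : K)) := by
      intro a b hab
      have q := Subtype.ext_iff.1 hab
      exact Subtype.ext (hf.1 q)
    exact ⟨this, Finite.surjective_of_injective this⟩
  have nd : NonDouble X := by
    intro f g hf hg
    obtain ⟨v⟩ := neK
    obtain ⟨x, hx⟩ := (hbij f hf).2 v
    obtain ⟨y, hy⟩ := (hbij g hg).2 v
    exact ⟨x.1, y.1, (Subtype.ext_iff.1 (hx.trans hy.symm) :)⟩
  refine ⟨?_, nd⟩
  by_cases hR : Rigid X
  · exact Or.inl hR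
  right
  simp only [Rigid, not_forall] at hR
  obtain ⟨Y, hY, ⟨⟨f, hf⟩, ⟨g, hg⟩⟩, hni⟩ := hR
  let k : K → X.V := Subtype.val
  let K0 : SimpleGraph K := X.G.comap k
  let kl : K → L := fun a => X.lab a.1
  obtain ⟨fX, hfX, sX, fXk⟩ := build_iso X k Subtype.val_injective K0 kl
    (fun _ _ => Iff.rfl) (fun _ => rfl)
  obtain ⟨fY, hfY, sY, fYk⟩ := build_iso Y (f ∘ k) (hf.1.comp Subtype.val_injective) K0 kl
    (fun a b => hf.2.1 _ _) (fun a => hf.2.2 _)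
  obtain ⟨I, C, cC, iC⟩ := exists_comps (rest X k)
  obtain ⟨J, D, cD, iD⟩ := exists_comps (rest Y (f ∘ k))
  -- `X` and `Y` as built graphs
  obtain ⟨t0, ht0, st0, t0k⟩ : ∃ t, IsEmb (build K0 kl (LG.sum C)) X t ∧
      Function.Surjective t ∧ ∀ a : K, t (.inl a) = a.1 := by
    obtain ⟨b, hb, sb, bk⟩ := build_iso' (K0 := K0) (kl := kl) iC
    exact ⟨fX ∘ b, hfX.comp hb, sX.comp sb, fun a => (congrArg fX (bk a)).trans (fXk a)⟩
  obtain ⟨t1, ht1, st1, t1k⟩ : ∃ t, IsEmb (build K0 kl (LG.sum D)) Y t ∧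
      Function.Surjective t ∧ ∀ a : K, t (.inl a) = f a.1 := by
    obtain ⟨b, hb, sb, bk⟩ := build_iso' (K0 := K0) (kl := kl) iD
    exact ⟨fY ∘ b, hfY.comp hb, sY.comp sb, fun a => (congrArg fY (bk a)).trans (fYk a)⟩
  obtain ⟨u0, hu0, su0, u0t0, t0u0⟩ := ht0.inv st0
  obtain ⟨u1, hu1, su1, u1t1, t1u1⟩ := ht1.inv st1
  have u0k : ∀ a : K, u0 a.1 = .inl a := fun a =>
    (congrArg u0 (t0k a)).symm.trans (u0t0 (.inl a))
  have u1k : ∀ a : K, u1 (f a.1) = .inl a := fun a =>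
    (congrArg u1 (t1k a)).symm.trans (u1t1 (.inl a))
  have le1 : Le (LG.sum C) (LG.sum D) :=
    build_rest_le (hu1.comp (hf.comp ht0)) fun a =>
      (congrArg (fun v => u1 (f v)) (t0k a)).trans (u1k a)
  -- power of `g ∘ f` that fixes the kernel
  have hp : IsEmb X X (g ∘ f) := hg.comp hf
  obtain ⟨n, hn⟩ : ∃ n, ∀ a ∈ K, (g ∘ f)^[n + 1] a = a := by
    let π : Equiv.Perm K := Equiv.ofBijective _ (hbij _ hp)
    have hπ : ∀ m, ∀ a : K, ((π ^ m) a).1 = (g ∘ f)^[m] a.1 := by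
      intro m
      induction m with
      | zero => intro a; rfl
      | succ m ih =>
        intro a
        rw [pow_succ', Function.iterate_succ_apply', ← ih]
        rfl
    refine ⟨orderOf π - 1, fun a ha => ?_⟩
    rw [Nat.sub_add_cancel (orderOf_pos π)]
    have := hπ (orderOf π) ⟨a, ha⟩
    rw [pow_orderOf_eq_one] at this
    exact this.symm
  have le2 : Le (LG.sum D) (LG.sum C) :=
    build_rest_le (hu0.comp (((hp.iterate n).comp hg).comp ht1)) fun a => by
      have := hn a.1 a.2
      rw [Function.iterate_succ_apply] at this
      have h2 : (g ∘ f)^[n] (g (f a.1)) = a.1 := this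
      exact (congrArg (fun v => u0 ((g ∘ f)^[n] (g v))) (t1k a)).trans
        ((congrArg u0 h2).trans (u0k a))
  have hni' : ¬ Iso (LG.sum C) (LG.sum D) := by
    intro h
    obtain ⟨b, hb, sb, -⟩ := build_iso' (K0 := K0) (kl := kl) h
    exact hni ⟨_, ht1.comp (hb.comp hu0), st1.comp (sb.comp su0)⟩
  have aC : ∀ i, Att (C i) := fun i =>
    att_of_build neK (hX.iso ⟨u0, hu0, su0⟩) i (cC i)
  have aD : ∀ i, Att (D i) := fun i =>
    att_of_build neK (hY.iso ⟨u1, hu1, su1⟩) i (cD i)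
  have rkC : ∀ i, ∃ β < α, HasRk (C i).G β Set.univ := by
    intro i
    let q : (C i).V → X.V := fun x => t0 (.inr ⟨i, x⟩)
    have hq : ∀ x y, (C i).G.Adj x y → X.G.Adj (q x) (q y) := fun x y h =>
      (ht0.2.1 _ _).2 (SAdj.mk i x y h)
    have qi : Function.Injective q := fun x y h =>
      sigma_mk_inj (Sum.inr.inj (ht0.1 h))
    obtain ⟨β, hβ, hb⟩ := hKw (q '' Set.univ) (by
      rintro _ ⟨x, -, rfl⟩ hx
      have h1 := t0k ⟨_, hx⟩
      have h2 := ht0.1 h1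
      cases h2) (conn_image hq (cC i))
    refine ⟨β, hβ, ?_⟩
    have := HasRk.preimage hq qi hb
    rwa [Set.preimage_image_eq _ qi] at this
  have rkD : ∀ j, ∃ β < α, HasRk (D j).G β Set.univ := by
    intro j
    obtain ⟨g', hg'⟩ := le2
    obtain ⟨φ, e, he, -⟩ := emb_decomp cD hg'
    obtain ⟨β, hβ, hb⟩ := rkC (φ j)
    exact ⟨β, hβ, HasRk.preimage (fun x y h => ((he j).2.1 x y).2 h) (he j).1 hb⟩
  have gC := fun i => (rkC i).elim fun β h => IH β h.1 _ (C i) (cC i) h.2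
  have gD := fun j => (rkD j).elim fun β h => IH β h.1 _ (D j) (cD j) h.2
  obtain ⟨F, FA, FT, FI⟩ := family (Q := Att) (fun _ h => h.1) att_mono aC aD
    (fun i => (gC i).1) (fun i => (gD i).1) (fun i => (gC i).2) (fun i => (gD i).2)
    ⟨le1, le2⟩ hni'
  let Xn : ℕ → LG L := fun n => build K0 kl (LG.sum (F n).2)
  have hs : ∀ n, ∃ s, IsEmb X (Xn n) s ∧ ∀ a : K, s a.1 = .inl a := by
    intro n
    obtain ⟨b, hb, bk⟩ := build_le (K0 := K0) (kl := kl) (FT n).1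
    exact ⟨b ∘ u0, hb.comp hu0, fun a => (congrArg b (u0k a)).trans (bk a)⟩
  have ht : ∀ n, ∃ t, IsEmb (Xn n) X t ∧ ∀ a : K, t (.inl a) = a.1 := by
    intro n
    obtain ⟨b, hb, bk⟩ := build_le (K0 := K0) (kl := kl) (FT n).2
    exact ⟨t0 ∘ b, ht0.comp hb, fun a => (congrArg t0 (bk a)).trans (t0k a)⟩
  choose s hs sk using hs
  choose t ht tk using ht
  refine infTw_of_seq Xn (fun n => build_cn hX neK (FA n) k (s n) (hs n) (sk n))
    (fun n => ⟨⟨_, hs n⟩, ⟨_, ht n⟩⟩) fun n => ?_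
  have hθ : ∀ m : {m | Iso (Xn m) (Xn n)}, ∃ θ, (IsEmb (Xn m.1) (Xn n) θ ∧
      Function.Surjective θ) ∧ ∃ τ : K → K, ∀ a, θ (.inl a) = .inl (τ a) := by
    rintro ⟨m, θ, hθ, sθ⟩
    refine ⟨θ, ⟨hθ, sθ⟩, ?_⟩
    have h1 : ∀ a : K, ∃ b : K, θ (.inl a) = .inl b := by
      intro a
      have h2 := hK _ ((ht n).comp (hθ.comp (hs m))) a.1 a.2
      simp only [Function.comp_apply] at h2
      rw [sk] at h2
      refine ⟨⟨_, h2⟩, ?_⟩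
      exact (ht n).1 (tk n ⟨_, h2⟩).symm
    choose τ hτ using h1
    exact ⟨τ, hτ⟩
  choose θ hθ τ hτ using hθ
  have hτi : Function.Injective τ := by
    intro m m' hmm
    obtain ⟨w, hw, sw, wl, -⟩ := (hθ m').1.inv (hθ m').2
    apply Subtype.ext
    apply FI
    refine build_rest_iso (hw.comp (hθ m).1) (sw.comp (hθ m).2) fun a => ?_
    exact (congrArg w ((hτ m a).trans
      ((congrArg Sum.inl (congrFun hmm a)).trans (hτ m' a).symm))).trans (wl (.inl a))
  have : Finite {m | Iso (Xn m) (Xn n)} := Finite.of_injective τ hτi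
  exact Set.toFinite _

theorem main {L : Type u} (X : LG L) (hX : Cn X) (α : Ordinal.{u})
    (hr : HasRk X.G α Set.univ) : (Rigid X ∨ InfTw X) ∧ NonDouble X := by
  induction α using WellFoundedLT.induction generalizing L with
  | ind α ih =>
    by_cases h : ∃ β < α, HasRk X.G β Set.univ
    · obtain ⟨β, hβ, hb⟩ := h
      exact ih β hβ X hX hb
    · push Not at h
      exact step (fun β hβ L X hX hb => ih β hβ X hX hb) X hX hr h

theorem cn_iff {V : Type u} (G : SimpleGraph V) :
    Conn G Set.univ ↔ G.Connected := by
  constructor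
  · intro h
    have : Nonempty V := ⟨h.1.choose⟩
    refine SimpleGraph.Connected.mk fun x y => ?_
    refine h.2 {y | G.Reachable x y} ⟨x, trivial, SimpleGraph.Reachable.refl x⟩ ?_ trivial
    intro a _ b _ ha hab
    exact SimpleGraph.Reachable.trans ha hab.reachable
  · intro h
    obtain ⟨v⟩ := h.nonempty
    refine ⟨⟨v, trivial⟩, ?_⟩
    rintro P ⟨x, -, hx⟩ hP y -
    obtain ⟨w⟩ := h.preconnected x y
    induction w with
    | nil => exact hx
    | cons hab w ih => exact ih (hP _ trivial _ trivial hx hab)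

def un {V : Type u} (G : SimpleGraph V) : LG PUnit.{u + 1} := ⟨V, G, fun _ => ⟨⟩⟩

theorem le_iff (X Y : LG PUnit.{u + 1}) : Le X Y ↔ Nonempty (X.G ↪g Y.G) := by
  constructor
  · rintro ⟨f, hf⟩
    exact ⟨⟨⟨f, hf.1⟩, hf.2.1 _ _⟩⟩
  · rintro ⟨f⟩
    exact ⟨f, f.injective, fun x y => f.map_adj_iff, fun _ => rfl⟩

theorem iso_iff (X Y : LG PUnit.{u + 1}) : Iso X Y ↔ Nonempty (X.G ≃g Y.G) := by
  constructor
  · rintro ⟨f, hf, sf⟩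
    exact ⟨⟨Equiv.ofBijective f ⟨hf.1, sf⟩, hf.2.1 _ _⟩⟩
  · rintro ⟨f⟩
    exact ⟨f, ⟨f.injective, fun x y => f.map_adj_iff, fun _ => rfl⟩, f.surjective⟩

end RT


/-- A connected rayless graph has either no connected strong twin or infinitely many
pairwise non-isomorphic connected strong twins. -/
theorem connected_rayless_strongTwin_alternative {V : Type u} (G : SimpleGraph V)
    (hG : G.IsRayless) (hGc : G.Connected) :
    (¬ ∃ (W : Type u) (H : SimpleGraph W), H.Connected ∧ G.StrongTwins H) ∨
    (∃ F : ℕ → Σ W : Type u, SimpleGraph W,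
      (∀ i, (F i).2.Connected) ∧
      (∀ i j, i ≠ j → ¬ Nonempty ((F i).2 ≃g (F j).2)) ∧
      ∀ i, G.StrongTwins (F i).2) := by
  have hr := RT.rayless_rank hG ((RT.cn_iff G).2 hGc)
  obtain ⟨α, hα⟩ := hr
  have hsym : ∀ {X Y : RT.LG PUnit.{u + 1}}, RT.Iso X Y → RT.Iso Y X := by
    intro X Y h
    rw [RT.iso_iff] at h ⊢
    exact h.map fun e => e.symm
  have htr : ∀ {X Y Z : RT.LG PUnit.{u + 1}}, RT.Iso X Y → RT.Iso Y Z → RT.Iso X Z := by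
    intro X Y Z h h2
    rw [RT.iso_iff] at h h2 ⊢
    obtain ⟨e⟩ := h
    obtain ⟨e2⟩ := h2
    exact ⟨e.trans e2⟩
  rcases (RT.main (RT.un G) ((RT.cn_iff G).2 hGc) α hα).1 with h | ⟨F, Fc, Ft, Fi⟩
  · left
    rintro ⟨W, H, hH, hn, h1, h2⟩
    exact hn ((RT.iso_iff (RT.un G) (RT.un H)).1 (h (RT.un H) ((RT.cn_iff H).2 hH)
      ⟨(RT.le_iff (RT.un G) (RT.un H)).2 h1, (RT.le_iff (RT.un H) (RT.un G)).2 h2⟩))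
  · right
    obtain ⟨m, hm⟩ : ∃ m, ∀ k, ¬ RT.Iso (RT.un G) (F (k + m)) := by
      by_cases hn : ∃ n, RT.Iso (RT.un G) (F n)
      · obtain ⟨n, hn⟩ := hn
        refine ⟨n + 1, fun k hk => ?_⟩
        have := Fi _ _ (htr (hsym hk) hn)
        omega
      · exact ⟨0, fun k hk => hn ⟨_, hk⟩⟩
    refine ⟨fun k => ⟨(F (k + m)).V, (F (k + m)).G⟩, fun i => (RT.cn_iff _).1 (Fc _), ?_, ?_⟩
    · intro i j hij h
      have := Fi _ _ ((RT.iso_iff (F (i + m)) (F (j + m))).2 h)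
      omega
    · intro i
      exact ⟨fun h => hm i ((RT.iso_iff (RT.un G) (F (i + m))).2 h),
        (RT.le_iff (RT.un G) (F (i + m))).1 (Ft _).1,
        (RT.le_iff (F (i + m)) (RT.un G)).1 (Ft _).2⟩
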